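/- arXiv:2403.02673 — 5 statements merged into one kernel-verified Lean document; each statement's English description precedes it below -/
import Mathlib

section
/- Let X be an absolutely continuous random variable whose cdf F is continuous and strictly increasing on the support of its density f, with quantile function Q : (0,1) → ℝ satisfying F(Q(u)) = u, and let w : ℝ → [0,∞) be a nonnegative weight function. If n is even, then the GWE of the extreme ranked set sample satisfies J^w(X_{ERSS}^{(n)}) = (Q_{1,n}/2) · (E[Λ_X^w(B_{1:2n-1})])^{n/2} · (E[Λ_X^w(B_{2n-1:2n-1})])^{n/2}, where Q_{1,n} = -n^{2n}/(2n-1)^n, and B_{2i-1:2n-1} denotes a Beta(2i-1, 2n-2i+1) random variable with density φ_{2i-1:2n-1}(u) = ((2n-1)!/((2i-2)!(2n-2i)!)) u^{2i-2}(1-u)^{2n-2i} on (0,1). -/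
open MeasureTheory Set

/-- Density of the `i`-th order statistic from a sample of size `n`. -/
noncomputable def ordStatDensity (f F : ℝ → ℝ) (n i : ℕ) (x : ℝ) : ℝ :=
  ((Nat.factorial n : ℝ) / ((Nat.factorial (i - 1) : ℝ) * (Nat.factorial (n - i) : ℝ))) *
    (F x) ^ (i - 1) * (1 - F x) ^ (n - i) * f x

/-- General weighted extropy of an extreme ranked set sample of size `n`. -/
noncomputable def JERSS (w f F : ℝ → ℝ) (n : ℕ) : ℝ :=
  if Even n then
    -(1/2) * (∫ x, w x * (ordStatDensity f F n 1 x) ^ 2) ^ (n / 2) *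
      (∫ x, w x * (ordStatDensity f F n n x) ^ 2) ^ (n / 2)
  else
    -(1/2) * (∫ x, w x * (ordStatDensity f F n 1 x) ^ 2) ^ ((n - 1) / 2) *
      (∫ x, w x * (ordStatDensity f F n n x) ^ 2) ^ ((n - 1) / 2) *
      (∫ x, w x * (ordStatDensity f F n ((n + 1) / 2) x) ^ 2)

/-- The distribution function of a nonnegative density is monotone. -/
theorem monotone_of_eq_integral_Iic
    {f F : ℝ → ℝ} (hf_nonneg : ∀ x, 0 ≤ f x) (hf_int : Integrable f)
    (hF : ∀ x, F x = ∫ t in Iic x, f t) : Monotone F := fun x y hxy => by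
  rw [hF, hF]
  exact setIntegral_mono_set hf_int.integrableOn (ae_of_all _ hf_nonneg)
    (Iic_subset_Iic.2 hxy).eventuallyLE

/-- A quantile function pushes the uniform law on `(0,1)` forward to the law with density `f`. -/
theorem map_quantile_eq_withDensity
    {f F Q : ℝ → ℝ} (hf_nonneg : ∀ x, 0 ≤ f x) (hf_int : Integrable f)
    (hf_one : ∫ x, f x = 1) (hF : ∀ x, F x = ∫ t in Iic x, f t)
    (hQ : ∀ u ∈ Ioo (0:ℝ) 1, F (Q u) = u)
    (hQ_meas : Measurable fun u : Ioo (0:ℝ) 1 => Q u) :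
    (Measure.comap ((↑) : Ioo (0:ℝ) 1 → ℝ) volume).map (fun u : Ioo (0:ℝ) 1 => Q u) =
      volume.withDensity fun x => ENNReal.ofReal (f x) := by
  have hF_mono := monotone_of_eq_integral_Iic hf_nonneg hf_int hF
  have hF_le (x : ℝ) : F x ≤ 1 := by
    rw [hF, ← hf_one]
    exact setIntegral_le_integral hf_int (ae_of_all _ hf_nonneg)
  have : IsFiniteMeasure (Measure.comap ((↑) : Ioo (0:ℝ) 1 → ℝ) volume) := by
    refine ⟨?_⟩
    rw [(MeasurableEmbedding.subtype_coe measurableSet_Ioo).comap_apply, image_univ,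
      Subtype.range_coe]
    simp
  have := Measure.isFiniteMeasure_map (Measure.comap ((↑) : Ioo (0:ℝ) 1 → ℝ) volume)
    (fun u : Ioo (0:ℝ) 1 => Q u)
  refine Measure.ext_of_Iic _ _ fun x => ?_
  rw [Measure.map_apply hQ_meas measurableSet_Iic,
    (MeasurableEmbedding.subtype_coe measurableSet_Ioo).comap_apply,
    withDensity_apply _ measurableSet_Iic,
    ← ofReal_integral_eq_lintegral_ofReal hf_int.integrableOn (ae_of_all _ hf_nonneg), ← hF]
  apply le_antisymm
  · calc
      _ ≤ volume (Ioc 0 (F x)) := by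
        refine measure_mono ?_
        rintro _ ⟨u, hu, rfl⟩
        exact ⟨u.2.1, (hQ u u.2).symm.le.trans (hF_mono hu)⟩
      _ = _ := by simp
  · calc
      _ = volume (Ioo 0 (F x)) := by simp
      _ ≤ _ := by
        refine measure_mono fun u hu => ?_
        have hu1 : u ∈ Ioo (0:ℝ) 1 := ⟨hu.1, hu.2.trans_le (hF_le x)⟩
        refine ⟨⟨u, hu1⟩, ?_, rfl⟩
        by_contra hx
        exact hu.2.not_ge ((hF_mono (not_le.1 hx).le).trans (hQ u hu1).le)

/-- The quantile substitution, valid for every integrand since `Q` is a measurable embedding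
of `(0,1)`. -/
theorem integral_mul_density_eq_integral_quantile
    {f F Q : ℝ → ℝ} (hf_nonneg : ∀ x, 0 ≤ f x) (hf_int : Integrable f)
    (hf_one : ∫ x, f x = 1) (hF : ∀ x, F x = ∫ t in Iic x, f t)
    (hQ : ∀ u ∈ Ioo (0:ℝ) 1, F (Q u) = u) (H : ℝ → ℝ) :
    ∫ x, f x * H x = ∫ u in Ioo (0:ℝ) 1, H (Q u) := by
  have hF_mono := monotone_of_eq_integral_Iic hf_nonneg hf_int hF
  have hQ_mono : StrictMono fun u : Ioo (0:ℝ) 1 => Q u := fun u v huv => by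
    refine hF_mono.reflect_lt ?_
    rwa [hQ u u.2, hQ v v.2]
  have hQ_meas := hQ_mono.monotone.measurable
  have : StandardBorelSpace (Ioo (0:ℝ) 1) := measurableSet_Ioo.standardBorel
  have hQ_emb := hQ_meas.measurableEmbedding hQ_mono.injective
  rw [← integral_subtype_comap measurableSet_Ioo (fun u => H (Q u)),
    ← hQ_emb.integral_map (g := H),
    map_quantile_eq_withDensity hf_nonneg hf_int hf_one hF hQ hQ_meas,
    integral_withDensity_eq_integral_toReal_smul₀ hf_int.aemeasurable.ennreal_ofReal (by simp)]
  simp [ENNReal.toReal_ofReal (hf_nonneg _)]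

/-- The minimum of a sample of size `n` has density `n (1 - F)^(n-1) f`. -/
theorem ordStatDensity_one (f F : ℝ → ℝ) {n : ℕ} (hn : 1 ≤ n) (x : ℝ) :
    ordStatDensity f F n 1 x = n * (1 - F x) ^ (n - 1) * f x := by
  have h : ((n - 1).factorial : ℝ) ≠ 0 := by positivity
  simp only [ordStatDensity, ← Nat.mul_factorial_pred (Nat.one_le_iff_ne_zero.1 hn)]
  push_cast
  field_simp
  simp

/-- The maximum of a sample of size `n` has density `n F^(n-1) f`. -/
theorem ordStatDensity_self (f F : ℝ → ℝ) {n : ℕ} (hn : 1 ≤ n) (x : ℝ) :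
    ordStatDensity f F n n x = n * F x ^ (n - 1) * f x := by
  have h : ((n - 1).factorial : ℝ) ≠ 0 := by positivity
  simp only [ordStatDensity, ← Nat.mul_factorial_pred (Nat.one_le_iff_ne_zero.1 hn)]
  push_cast
  field_simp
  simp


theorem stmt_1
    (f F Q : ℝ → ℝ)
    (hf_nonneg : ∀ x, 0 ≤ f x)
    (hf_int : Integrable f)
    (hf_one : ∫ x, f x = 1)
    (hF : ∀ x, F x = ∫ t in Iic x, f t)
    (hF_cont : Continuous F)
    (hF_mono : StrictMonoOn F (Function.support f))
    (hQ : ∀ u ∈ Ioo (0:ℝ) 1, F (Q u) = u)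
    (w : ℝ → ℝ) (hw_nonneg : ∀ x, 0 ≤ w x)
    (n : ℕ) (hn : 1 ≤ n) (hne : Even n) :
    JERSS w f F n =
      (-(n:ℝ) ^ (2 * n) / (2 * (n:ℝ) - 1) ^ n) / 2 *
        (∫ u in Ioo (0:ℝ) 1,
            (w (Q u) * f (Q u)) * ((2 * (n:ℝ) - 1) * (1 - u) ^ (2 * n - 2))) ^ (n / 2) *
        (∫ u in Ioo (0:ℝ) 1,
            (w (Q u) * f (Q u)) * ((2 * (n:ℝ) - 1) * u ^ (2 * n - 2))) ^ (n / 2) := by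
  have hn' : (1:ℝ) ≤ n := by exact_mod_cast hn
  have hc : (n:ℝ) * 2 - 1 ≠ 0 := by linarith
  have hexp : 2 * n - 2 = (n - 1) * 2 := by omega
  have key (g : ℝ → ℝ) :
      ∫ x, w x * (n * g (F x) ^ (n - 1) * f x) ^ 2 =
        (n:ℝ) ^ 2 / (2 * n - 1) * ∫ u in Ioo (0:ℝ) 1,
          (w (Q u) * f (Q u)) * ((2 * (n:ℝ) - 1) * g u ^ (2 * n - 2)) := by
    rw [← integral_const_mul]
    calc
      _ = ∫ x, f x * ((n:ℝ) ^ 2 * (w x * f x * g (F x) ^ (2 * n - 2))) := by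
        congr 1 with x
        rw [hexp, pow_mul]
        ring
      _ = _ := by
        rw [integral_mul_density_eq_integral_quantile hf_nonneg hf_int hf_one hF hQ]
        refine setIntegral_congr_fun measurableSet_Ioo fun u hu => ?_
        simp only [hQ u hu]
        field_simp
  simp only [JERSS, if_pos hne, ordStatDensity_one f F hn, ordStatDensity_self f F hn]
  rw [key fun u => 1 - u, key fun u => u, mul_pow, mul_pow]
  obtain ⟨m, rfl⟩ := hne
  have hm : (m + m) / 2 = m := by omega
  have hpow : (-((m + m : ℕ) : ℝ) ^ (2 * (m + m)) / (2 * ((m + m : ℕ) : ℝ) - 1) ^ (m + m)) =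
      -((((m + m : ℕ) : ℝ) ^ 2 / (2 * ((m + m : ℕ) : ℝ) - 1)) ^ m *
        (((m + m : ℕ) : ℝ) ^ 2 / (2 * ((m + m : ℕ) : ℝ) - 1)) ^ m) := by
    rw [← pow_add, div_pow, ← pow_mul, neg_div]
  rw [hm, hpow]
  ring
end

section
/- Let X be an absolutely continuous random variable with density f and cdf F, and let w_1 : ℝ → [0,∞) be a nonnegative weight function such that ∫ w_1(x) f(x)^2 dx is finite. Then for every odd n ≥ 1, J^{w_1}(X_{ERSS}^{(n)}) ≥ (n^{2(n-1)} (n!)^2 / (((n-1)/2)!)^4) · J^{w_1}(X_{SRS}^{(n)}). -/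
open MeasureTheory Set

/-- General weighted extropy of a simple random sample of size `n`. -/
noncomputable def JSRS (w f : ℝ → ℝ) (n : ℕ) : ℝ :=
  -(1/2) * (∫ x, w x * (f x) ^ 2) ^ n

/-- The squared density of an order statistic is dominated by a multiple of `f ^ 2`. -/
theorem integral_mul_ordStatDensity_sq_le {f F w : ℝ → ℝ} (hF : ∀ x, F x ∈ Icc (0 : ℝ) 1)
    (hw : ∀ x, 0 ≤ w x) (hwf : Integrable (fun x => w x * (f x) ^ 2)) (n i : ℕ) :
    ∫ x, w x * (ordStatDensity f F n i x) ^ 2 ≤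
      ((Nat.factorial n : ℝ) / ((Nat.factorial (i - 1) : ℝ) * (Nat.factorial (n - i) : ℝ))) ^ 2 *
        ∫ x, w x * (f x) ^ 2 := by
  rw [← integral_const_mul]
  refine integral_mono_of_nonneg (.of_forall fun x => mul_nonneg (hw x) (sq_nonneg _))
    (hwf.const_mul _) (.of_forall fun x => ?_)
  obtain ⟨h0, h1⟩ := hF x
  have hp : (F x ^ (i - 1) * (1 - F x) ^ (n - i)) ^ 2 ≤ 1 :=
    pow_le_one₀ (by have := sub_nonneg.2 h1; positivity)
      (mul_le_one₀ (pow_le_one₀ h0 h1) (pow_nonneg (sub_nonneg.2 h1) _)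
        (pow_le_one₀ (sub_nonneg.2 h1) (by linarith)))
  have hwx := hw x
  simp only [ordStatDensity]
  set c := (Nat.factorial n : ℝ) / ((Nat.factorial (i - 1) : ℝ) * (Nat.factorial (n - i) : ℝ))
  calc w x * (c * F x ^ (i - 1) * (1 - F x) ^ (n - i) * f x) ^ 2
      = c ^ 2 * (w x * f x ^ 2) * (F x ^ (i - 1) * (1 - F x) ^ (n - i)) ^ 2 := by ring
    _ ≤ c ^ 2 * (w x * f x ^ 2) := mul_le_of_le_one_right (by positivity) hp

theorem stmt_6
    (f F w1 : ℝ → ℝ)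
    (hf_nonneg : ∀ x, 0 ≤ f x)
    (hf_int : Integrable f)
    (hf_one : ∫ x, f x = 1)
    (hF : ∀ x, F x = ∫ t in Iic x, f t)
    (hw1_nonneg : ∀ x, 0 ≤ w1 x)
    (hwf_int : Integrable (fun x => w1 x * (f x) ^ 2))
    (n : ℕ) (hn : 1 ≤ n) (hno : Odd n) :
    ((n:ℝ) ^ (2 * (n - 1)) * (Nat.factorial n : ℝ) ^ 2 /
        (Nat.factorial ((n - 1) / 2) : ℝ) ^ 4) * JSRS w1 f n ≤ JERSS w1 f F n := by
  have hF01 : ∀ x, F x ∈ Icc (0 : ℝ) 1 := fun x => by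
    rw [hF x, ← hf_one]
    exact ⟨setIntegral_nonneg measurableSet_Iic fun t _ => hf_nonneg t,
      setIntegral_le_integral hf_int (.of_forall hf_nonneg)⟩
  have hint_nonneg : ∀ g : ℝ → ℝ, 0 ≤ ∫ x, w1 x * (g x) ^ 2 := fun g =>
    integral_nonneg fun x => mul_nonneg (hw1_nonneg x) (sq_nonneg _)
  obtain ⟨k, rfl⟩ := hno
  have hbound := integral_mul_ordStatDensity_sq_le hF01 hw1_nonneg hwf_int (2 * k + 1)
  have hfac : (Nat.factorial (2 * k + 1) : ℝ) / Nat.factorial (2 * k) = (2 * k + 1 : ℕ) := by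
    rw [Nat.factorial_succ, Nat.cast_mul, mul_div_cancel_right₀ _ (by positivity)]
  have hmin := hbound 1
  have hmax := hbound (2 * k + 1)
  have hmed := hbound ((2 * k + 1 + 1) / 2)
  have hk1 : (2 * k + 1 + 1) / 2 = k + 1 := by omega
  have hk2 : (2 * k + 1 - 1) / 2 = k := by omega
  have hk3 : 2 * k + 1 - (k + 1) = k := by omega
  rw [hk1, Nat.add_sub_cancel, hk3] at hmed
  simp only [Nat.sub_self, Nat.add_sub_cancel, Nat.factorial_zero, Nat.cast_one, one_mul, mul_one,
    hfac] at hmin hmax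
  rw [JERSS, JSRS, if_neg (by simp), hk1, hk2, Nat.add_sub_cancel]
  have hA := hint_nonneg (ordStatDensity f F (2 * k + 1) 1)
  have hB := hint_nonneg (ordStatDensity f F (2 * k + 1) (2 * k + 1))
  have hC := hint_nonneg (ordStatDensity f F (2 * k + 1) (k + 1))
  have hI := hint_nonneg f
  have hprod := mul_le_mul (mul_le_mul (pow_le_pow_left₀ hA hmin k) (pow_le_pow_left₀ hB hmax k)
    (by positivity) (by positivity)) hmed hC (by positivity)
  set N : ℝ := ((2 * k + 1 : ℕ) : ℝ)
  set I := ∫ x, w1 x * f x ^ 2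
  set M : ℝ := (Nat.factorial (2 * k + 1) : ℝ)
  set K : ℝ := (Nat.factorial k : ℝ)
  have hrw : (N ^ 2 * I) ^ k * (N ^ 2 * I) ^ k * ((M / (K * K)) ^ 2 * I) =
      N ^ (2 * (2 * k)) * M ^ 2 / K ^ 4 * I ^ (2 * k + 1) := by
    ring
  rw [hrw] at hprod
  linarith
end

section
/- Let X be an absolutely continuous random variable whose density f satisfies f(x) = f(-x) for all x ∈ ℝ, whose cdf F is continuous and strictly increasing on the support of f. Let w_1 : ℝ → ℝ be a weight function satisfying w_1(-x) = -w_1(x) for all x. Then for every odd integer n ≥ 1, the general weighted extropy of the extreme ranked set sample vanishes: J^{w_1}(X_{ERSS}^{(n)}) = 0. -/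
open MeasureTheory Set

theorem integral_eq_zero_of_odd {g : ℝ → ℝ} (hg : ∀ x, g (-x) = -g x) : ∫ x, g x = 0 := by
  have h := integral_neg_eq_self g volume
  simp only [hg, integral_neg] at h
  linarith

theorem setIntegral_Iic_neg_of_even {f : ℝ → ℝ} (hf_int : Integrable f)
    (hf_sym : ∀ x, f x = f (-x)) (x : ℝ) :
    ∫ t in Iic (-x), f t = (∫ t, f t) - ∫ t in Iic x, f t := by
  have h1 : ∫ t in Iic (-x), f t = ∫ t in Ioi x, f t := by
    have h := integral_comp_neg_Iic (-x) f
    simpa only [← hf_sym, neg_neg] using h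
  have h2 := intervalIntegral.integral_Iic_add_Ioi (b := x) hf_int.integrableOn hf_int.integrableOn
  linarith

/-- The density of the sample median is even when the parent distribution is symmetric. -/
theorem ordStatDensity_median_neg {f F : ℝ → ℝ} (hf_sym : ∀ x, f x = f (-x))
    (hF_sym : ∀ x, F (-x) = 1 - F x) (k : ℕ) (x : ℝ) :
    ordStatDensity f F (2 * k + 1) (k + 1) (-x) = ordStatDensity f F (2 * k + 1) (k + 1) x := by
  have hk : 2 * k + 1 - (k + 1) = k := by omega
  simp only [ordStatDensity, hF_sym, ← hf_sym, hk, Nat.add_sub_cancel]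
  ring

theorem stmt_9
    (f F w1 : ℝ → ℝ)
    (hf_nonneg : ∀ x, 0 ≤ f x)
    (hf_int : Integrable f)
    (hf_one : ∫ x, f x = 1)
    (hf_sym : ∀ x, f x = f (-x))
    (hF : ∀ x, F x = ∫ t in Iic x, f t)
    (hF_cont : Continuous F)
    (hF_mono : StrictMonoOn F (Function.support f))
    (hw1_odd : ∀ x, w1 (-x) = -w1 x)
    (n : ℕ) (hn : 1 ≤ n) (hno : Odd n) :
    JERSS w1 f F n = 0 := by
  have hF_sym : ∀ x, F (-x) = 1 - F x := fun x => by
    rw [hF, hF, setIntegral_Iic_neg_of_even hf_int hf_sym, hf_one]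
  obtain ⟨k, rfl⟩ := hno
  have hk : (2 * k + 1 + 1) / 2 = k + 1 := by omega
  rw [JERSS, if_neg (by simp), hk]
  refine mul_eq_zero_of_right _ (integral_eq_zero_of_odd fun x => ?_)
  rw [ordStatDensity_median_neg hf_sym hF_sym, hw1_odd, neg_mul]
end

section
/- Let X and Y be nonnegative absolutely continuous random variables with densities f and g that are continuous on [0,∞) and satisfy f(0) ≥ g(0) > 0, with cdfs F and G continuous and strictly increasing on their supports. If X ≤_su Y, i.e., the function ψ = G^{-1} ∘ F is superadditive on [0,∞) (ψ(x+y) ≥ ψ(x) + ψ(y) for all x, y ≥ 0), then X ≤_disp Y, i.e., ψ(x) - x is nondecreasing on the support of X. -/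
open MeasureTheory Set

theorem monotone_setIntegral_Iic {g : ℝ → ℝ} (hg_nonneg : ∀ x, 0 ≤ g x) (hg : Integrable g) :
    Monotone fun x => ∫ t in Iic x, g t := fun _ _ h =>
  setIntegral_mono_set hg.integrableOn (Filter.Eventually.of_forall hg_nonneg)
    (Iic_subset_Iic.2 h).eventuallyLE

theorem setIntegral_Iic_eq_setIntegral_Icc {g : ℝ → ℝ} (hg : ∀ x < (0 : ℝ), g x = 0) (x : ℝ) :
    ∫ t in Iic x, g t = ∫ t in Icc 0 x, g t := by
  refine (setIntegral_eq_of_subset_of_forall_sdiff_eq_zero measurableSet_Iic Icc_subset_Iic_self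
    fun t ht => hg t ?_)
  by_contra! h
  exact ht.2 ⟨h, ht.1⟩

theorem mul_le_setIntegral_Icc {f : ℝ → ℝ} (hf : Integrable f) {m t : ℝ} (ht : 0 ≤ t)
    (h : ∀ x ∈ Icc 0 t, m ≤ f x) : m * t ≤ ∫ x in Icc 0 t, f x := by
  have := setIntegral_mono_on (μ := volume) (s := Icc 0 t) (f := fun _ => m) (g := f)
    (by simp) hf.integrableOn measurableSet_Icc h
  simpa [ht, mul_comm] using this

theorem setIntegral_Icc_le_mul {f : ℝ → ℝ} (hf : Integrable f) {m t : ℝ} (ht : 0 ≤ t)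
    (h : ∀ x ∈ Icc 0 t, f x ≤ m) : ∫ x in Icc 0 t, f x ≤ m * t := by
  have := setIntegral_mono_on (μ := volume) (s := Icc 0 t) (f := f) (g := fun _ => m)
    hf.integrableOn (by simp) measurableSet_Icc h
  simpa [ht, mul_comm] using this

theorem exists_forall_Icc_of_continuousOn {f : ℝ → ℝ} (hf : ContinuousOn f (Ici 0)) {s : Set ℝ}
    (hs : s ∈ nhds (f 0)) : ∃ δ > 0, ∀ x ∈ Icc 0 δ, f x ∈ s := by
  have h := hf 0 self_mem_Ici hs
  obtain ⟨u, hu, hsub⟩ := mem_nhdsGE_iff_exists_Icc_subset.1 h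
  exact ⟨u, hu, hsub⟩

theorem nat_succ_mul_le_of_superadditive {ψ : ℝ → ℝ}
    (hsuper : ∀ x y, 0 ≤ x → 0 ≤ y → ψ x + ψ y ≤ ψ (x + y)) {t : ℝ} (ht : 0 ≤ t) (n : ℕ) :
    (n + 1 : ℝ) * ψ t ≤ ψ ((n + 1) * t) := by
  induction n with
  | zero => simp
  | succ n ih =>
    have h := hsuper ((n + 1) * t) t (by positivity) ht
    rw [show (n + 1) * t + t = ((n + 1 : ℕ) + 1) * t by push_cast; ring] at h
    push_cast at h ⊢
    linarith

/-- A superadditive function that dominates `c * t` for small `t > 0` dominates it everywhere. -/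
theorem mul_le_of_superadditive {ψ : ℝ → ℝ}
    (hsuper : ∀ x y, 0 ≤ x → 0 ≤ y → ψ x + ψ y ≤ ψ (x + y)) {c δ : ℝ} (hδ : 0 < δ)
    (h : ∀ t, 0 < t → t ≤ δ → c * t ≤ ψ t) {d : ℝ} (hd : 0 < d) : c * d ≤ ψ d := by
  obtain ⟨n, hn⟩ := exists_nat_ge (d / δ)
  have hn1 : (0 : ℝ) < n + 1 := by positivity
  have hle : d / (n + 1) ≤ δ := by
    rw [div_le_iff₀ hδ] at hn
    rw [div_le_iff₀ hn1]
    linarith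
  have h1 := h (d / (n + 1)) (by positivity) hle
  have h2 := nat_succ_mul_le_of_superadditive hsuper (t := d / (n + 1)) (by positivity) n
  rw [mul_div_cancel₀ d hn1.ne'] at h2
  calc c * d = (n + 1) * (c * (d / (n + 1))) := by field_simp
    _ ≤ (n + 1) * ψ (d / (n + 1)) := by gcongr
    _ ≤ ψ d := h2

theorem stmt_13
    (f g F G ψ : ℝ → ℝ)
    (hf_nonneg : ∀ x, 0 ≤ f x) (hf_int : Integrable f) (hf_one : ∫ x, f x = 1)
    (hg_nonneg : ∀ x, 0 ≤ g x) (hg_int : Integrable g) (hg_one : ∫ x, g x = 1)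
    (hf_supp : ∀ x < (0:ℝ), f x = 0) (hg_supp : ∀ x < (0:ℝ), g x = 0)
    (hf_cont : ContinuousOn f (Ici 0)) (hg_cont : ContinuousOn g (Ici 0))
    (h0 : g 0 ≤ f 0) (hg0_pos : 0 < g 0)
    (hF : ∀ x, F x = ∫ t in Iic x, f t) (hG : ∀ x, G x = ∫ t in Iic x, g t)
    (hF_cont : Continuous F) (hG_cont : Continuous G)
    (hF_mono : StrictMonoOn F (Function.support f))
    (hG_mono : StrictMonoOn G (Function.support g))
    (hψ : ∀ x, G (ψ x) = F x)
    (hsuper : ∀ x y, 0 ≤ x → 0 ≤ y → ψ x + ψ y ≤ ψ (x + y)) :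
    MonotoneOn (fun x => ψ x - x) (Function.support f) := by
  have key : ∀ c, 0 < c → c < 1 → ∃ δ > 0, ∀ t, 0 < t → t ≤ δ → c * t ≤ ψ t := by
    intro c hc0 hc1
    have hlt : g 0 < f 0 / c := by
      rw [lt_div_iff₀ hc0]
      nlinarith
    obtain ⟨M, hgM, hMf⟩ := exists_between hlt
    have hMf' : c * M < f 0 := by rwa [lt_div_iff₀ hc0, mul_comm] at hMf
    obtain ⟨m, hMm, hmf⟩ := exists_between hMf'
    obtain ⟨δ₁, hδ₁, h₁⟩ := exists_forall_Icc_of_continuousOn hf_cont (Ioi_mem_nhds hmf)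
    obtain ⟨δ₂, hδ₂, h₂⟩ := exists_forall_Icc_of_continuousOn hg_cont (Iio_mem_nhds hgM)
    refine ⟨min δ₁ δ₂, lt_min hδ₁ hδ₂, fun t ht htδ => ?_⟩
    have hct : c * t ≤ t := by nlinarith
    have hFt : m * t ≤ F t := by
      rw [hF, setIntegral_Iic_eq_setIntegral_Icc hf_supp]
      exact mul_le_setIntegral_Icc hf_int ht.le fun x hx =>
        (h₁ x ⟨hx.1, hx.2.trans (htδ.trans (min_le_left _ _))⟩).le
    have hGt : G (c * t) ≤ M * (c * t) := by
      rw [hG, setIntegral_Iic_eq_setIntegral_Icc hg_supp]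
      exact setIntegral_Icc_le_mul hg_int (by positivity) fun x hx =>
        (h₂ x ⟨hx.1, hx.2.trans (hct.trans (htδ.trans (min_le_right _ _)))⟩).le
    by_contra! hψt
    have hG_le : G (ψ t) ≤ G (c * t) := by
      simpa only [hG] using monotone_setIntegral_Iic hg_nonneg hg_int hψt.le
    rw [hψ] at hG_le
    nlinarith
  have hψ_ge : ∀ d, 0 < d → d ≤ ψ d := by
    intro d hd
    refine le_of_forall_lt_imp_le_of_dense fun a ha => ?_
    obtain ⟨b, hb, hbd⟩ := exists_between (max_lt ha hd)
    have hb0 : 0 < b := (le_max_right _ _).trans_lt hb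
    obtain ⟨δ, hδ, h⟩ := key (b / d) (by positivity) ((div_lt_one hd).2 hbd)
    have := mul_le_of_superadditive hsuper hδ h hd
    rw [div_mul_cancel₀ b hd.ne'] at this
    exact ((le_max_left _ _).trans hb.le).trans this
  intro x hx y _ hxy
  have hx0 : 0 ≤ x := by
    by_contra! h
    exact hx (hf_supp x h)
  rcases hxy.eq_or_lt with rfl | hlt
  · exact le_rfl
  have h1 := hψ_ge (y - x) (sub_pos.2 hlt)
  have h2 := hsuper x (y - x) hx0 (sub_pos.2 hlt).le
  rw [add_sub_cancel] at h2
  show ψ x - x ≤ ψ y - y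
  linarith
end

section
/- Let W have the exponential distribution with rate λ > 0, i.e., density f(x) = λ e^{-λ x} for x > 0, and take the weight function w_1(x) = x^m with m > 0. Then for every even n ≥ 2, J^{w_1}(W_{ERSS}^{(n)}) = -(n^n / (2^{n+1} (2n-1)^{n/2})) · λ^{-n(m-1)} · (E[W_{1:2n}^m])^{n/2} · (E[W_{2n-1:2n}^m])^{n/2}, where W_{k:2n} denotes the k-th order statistic of a sample of size 2n from the standard exponential distribution, so that E[W_{1:2n}^m] = ∫_0^∞ x^m · 2n e^{-2nx} dx and E[W_{2n-1:2n}^m] = ∫_0^∞ x^m · ((2n)!/((2n-2)!)) (1-e^{-x})^{2n-2} e^{-2x} dx. -/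
open MeasureTheory Set

/-- The cumulative distribution function of the exponential distribution on the positive axis. -/
lemma setIntegral_Iic_expDensity {lam : ℝ} {f : ℝ → ℝ}
    (hf : ∀ x, f x = if 0 < x then lam * Real.exp (-lam * x) else 0) {x : ℝ} (hx : 0 < x) :
    ∫ t in Iic x, f t = 1 - Real.exp (-(lam * x)) := by
  have hind : f = (Ioi (0 : ℝ)).indicator fun t => lam * Real.exp (-lam * t) := by
    ext t
    simp [hf, indicator_apply]
  rw [hind, setIntegral_indicator measurableSet_Ioi, inter_comm, Ioi_inter_Iic,
    ← intervalIntegral.integral_of_le hx.le]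
  have hderiv : ∀ t ∈ uIcc 0 x,
      HasDerivAt (fun t => -Real.exp (-lam * t)) (lam * Real.exp (-lam * t)) t := by
    intro t _
    have h := (((hasDerivAt_id t).const_mul (-lam)).exp).neg
    simp only [id, mul_one] at h
    exact h.congr_deriv (by ring)
  rw [intervalIntegral.integral_eq_sub_of_hasDerivAt hderiv
    (Continuous.intervalIntegrable (by fun_prop) _ _)]
  simp
  ring

/-- Scaling reduces the weighted squared density of an exponential order statistic to the
standard exponential distribution. -/
lemma integral_rpow_mul_ordStatDensity_sq {lam : ℝ} (m : ℝ) (hlam : 0 < lam) {f F : ℝ → ℝ}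
    (hf : ∀ x, f x = if 0 < x then lam * Real.exp (-lam * x) else 0)
    (hF : ∀ x, F x = ∫ t in Iic x, f t) (n i : ℕ) :
    ∫ x, x ^ m * (ordStatDensity f F n i x) ^ 2 =
      lam ^ (1 - m) * ∫ y in Ioi (0 : ℝ), y ^ m *
        (((Nat.factorial n : ℝ) / ((Nat.factorial (i - 1) : ℝ) * (Nat.factorial (n - i) : ℝ))) *
          (1 - Real.exp (-y)) ^ (i - 1) * Real.exp (-y) ^ (n - i) * Real.exp (-y)) ^ 2 := by
  set C : ℝ := (Nat.factorial n : ℝ) / ((Nat.factorial (i - 1) : ℝ) * (Nat.factorial (n - i) : ℝ))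
    with hC
  let h : ℝ → ℝ := fun y => y ^ m *
    (C * (1 - Real.exp (-y)) ^ (i - 1) * Real.exp (-y) ^ (n - i) * Real.exp (-y)) ^ 2
  have hsupp : ∫ x, x ^ m * (ordStatDensity f F n i x) ^ 2 =
      ∫ x in Ioi (0 : ℝ), x ^ m * (ordStatDensity f F n i x) ^ 2 := by
    refine (setIntegral_eq_integral_of_forall_compl_eq_zero fun x hx => ?_).symm
    have hfx : f x = 0 := (hf x).trans (if_neg hx)
    simp [ordStatDensity, hfx]
  have hscale : ∀ x ∈ Ioi (0 : ℝ), x ^ m * (ordStatDensity f F n i x) ^ 2 =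
      lam ^ (2 - m) * h (lam * x) := by
    intro x hx
    have hx' : 0 < x := hx
    have hpow : lam ^ (2 - m) * lam ^ m = lam ^ 2 := by
      rw [← Real.rpow_add hlam, ← Real.rpow_natCast]
      norm_num
    simp only [h, ordStatDensity, ← hC]
    rw [hF, setIntegral_Iic_expDensity hf hx', hf, if_pos hx',
      Real.mul_rpow hlam.le hx'.le, neg_mul, sub_sub_cancel]
    linear_combination (-(x ^ m * (C * (1 - Real.exp (-(lam * x))) ^ (i - 1) *
      Real.exp (-(lam * x)) ^ (n - i) * Real.exp (-(lam * x))) ^ 2)) * hpow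
  rw [hsupp, setIntegral_congr_fun measurableSet_Ioi hscale, integral_const_mul,
    integral_comp_mul_left_Ioi h 0 hlam, mul_zero, smul_eq_mul, ← mul_assoc,
    ← Real.rpow_neg_one lam, ← Real.rpow_add hlam]
  congr 2
  ring

theorem stmt_17
    (lam m : ℝ) (hlam : 0 < lam) (hm : 0 < m)
    (f F : ℝ → ℝ)
    (hf : ∀ x, f x = if 0 < x then lam * Real.exp (-lam * x) else 0)
    (hF : ∀ x, F x = ∫ t in Iic x, f t)
    (n : ℕ) (hn : 2 ≤ n) (hne : Even n) :
    JERSS (fun x => x ^ m) f F n =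
      -((n:ℝ) ^ n / (2 ^ (n + 1) * (2 * (n:ℝ) - 1) ^ (n / 2))) *
        lam ^ (-(n:ℝ) * (m - 1)) *
        (∫ x in Ioi (0:ℝ), x ^ m * (2 * (n:ℝ)) * Real.exp (-(2 * (n:ℝ)) * x)) ^ (n / 2) *
        (∫ x in Ioi (0:ℝ),
            x ^ m * ((Nat.factorial (2 * n) : ℝ) / (Nat.factorial (2 * n - 2) : ℝ)) *
              (1 - Real.exp (-x)) ^ (2 * n - 2) * Real.exp (-2 * x)) ^ (n / 2) := by
  have hn0 : (n : ℝ) ≠ 0 := by positivity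
  have hn2 : (2 : ℝ) ≤ n := by exact_mod_cast hn
  have h2n : 2 * (n : ℝ) - 1 ≠ 0 := by linarith
  have hfac : (Nat.factorial n : ℝ) = n * (Nat.factorial (n - 1) : ℝ) := by
    exact_mod_cast (Nat.mul_factorial_pred (by omega)).symm
  have hfac0 : (Nat.factorial (n - 1) : ℝ) ≠ 0 := by positivity
  have hfac2 : (Nat.factorial (2 * n) : ℝ) / (Nat.factorial (2 * n - 2) : ℝ) =
      2 * n * (2 * n - 1) := by
    obtain ⟨j, rfl⟩ := Nat.exists_eq_add_of_le' hn
    have hj : 2 * (j + 2) = 2 * (j + 2) - 2 + 1 + 1 := by omega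
    have hcast : ((2 * (j + 2) - 2 : ℕ) : ℝ) = 2 * ((j + 2 : ℕ) : ℝ) - 2 := by
      rw [Nat.cast_sub (by omega)]; push_cast; ring
    have hpos : (Nat.factorial (2 * (j + 2) - 2) : ℝ) ≠ 0 := by positivity
    rw [div_eq_iff hpos]
    conv_lhs => rw [hj, Nat.factorial_succ, Nat.factorial_succ]
    push_cast [hcast]
    ring
  have hmin : ∫ x, x ^ m * (ordStatDensity f F n 1 x) ^ 2 = lam ^ (1 - m) * (n / 2 *
      ∫ x in Ioi (0:ℝ), x ^ m * (2 * (n:ℝ)) * Real.exp (-(2 * (n:ℝ)) * x)) := by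
    rw [integral_rpow_mul_ordStatDensity_sq m hlam hf hF, ← integral_const_mul ((n : ℝ) / 2)]
    congr 2
    ext y
    have hexp : Real.exp (-(2 * (n : ℝ)) * y) =
        (Real.exp (-y) ^ (n - 1) * Real.exp (-y)) ^ 2 := by
      rw [← pow_succ, Nat.sub_add_cancel (by omega), ← pow_mul, ← Real.exp_nat_mul]
      push_cast
      ring_nf
    rw [hexp, hfac]
    simp only [Nat.sub_self, Nat.factorial_zero, pow_zero, Nat.cast_one]
    field_simp
  have hmax : ∫ x, x ^ m * (ordStatDensity f F n n x) ^ 2 =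
      lam ^ (1 - m) * (n / (2 * (2 * n - 1)) *
      ∫ x in Ioi (0:ℝ),
        x ^ m * ((Nat.factorial (2 * n) : ℝ) / (Nat.factorial (2 * n - 2) : ℝ)) *
          (1 - Real.exp (-x)) ^ (2 * n - 2) * Real.exp (-2 * x)) := by
    rw [integral_rpow_mul_ordStatDensity_sq m hlam hf hF, ← integral_const_mul ((n : ℝ) / (2 * (2 * n - 1)))]
    congr 2
    ext y
    have hexp : Real.exp (-2 * y) = Real.exp (-y) ^ 2 := by
      rw [← Real.exp_nat_mul]
      push_cast
      ring_nf
    have hpow : (1 - Real.exp (-y)) ^ (2 * n - 2) = ((1 - Real.exp (-y)) ^ (n - 1)) ^ 2 := by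
      rw [← pow_mul]
      congr 1
      omega
    rw [hexp, hpow, hfac2, hfac]
    simp only [Nat.sub_self, Nat.factorial_zero, pow_zero, Nat.cast_one]
    generalize 2 * (n : ℝ) - 1 = d at h2n ⊢
    field_simp
  have hlampow : lam ^ (-(n : ℝ) * (m - 1)) = (lam ^ (1 - m)) ^ n := by
    rw [← Real.rpow_natCast, ← Real.rpow_mul hlam.le]
    ring_nf
  simp only [JERSS, if_pos hne]
  rw [hmin, hmax, hlampow]
  generalize (∫ x in Ioi (0:ℝ), x ^ m * (2 * (n:ℝ)) * Real.exp (-(2 * (n:ℝ)) * x)) = A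
  generalize (∫ x in Ioi (0:ℝ),
    x ^ m * ((Nat.factorial (2 * n) : ℝ) / (Nat.factorial (2 * n - 2) : ℝ)) *
      (1 - Real.exp (-x)) ^ (2 * n - 2) * Real.exp (-2 * x)) = B
  generalize lam ^ (1 - m) = c
  generalize (n : ℝ) = a at *
  obtain ⟨k, rfl⟩ := hne
  rw [show (k + k) / 2 = k by omega]
  simp only [mul_pow, div_pow, pow_add, pow_one]
  field_simp
end
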